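/- Let A₁, ..., A_j be bounded convex subsets of ℝ^n whose joint affine span is a j-dimensional subspace W, and let u_{j+1}, ..., u_n be vectors in W^⊥. Let C = [0,u_{j+1}] + ... + [0,u_n] be the Minkowski sum of the segments [0, u_k]. Then j! · V_W(A₁,...,A_j) · Vol_{W^⊥}(C) = n! · V(A₁,...,A_j,[0,u_{j+1}],...,[0,u_n]), where V_W is the j-dimensional mixed volume in W and V is the n-dimensional mixed volume. -/

import Mathlib

open scoped Pointwise

/-- The mixed volume of `n` convex bodies `K 0, …, K (n-1)` in `ℝ^n`, characterized by the
polarization (inclusion–exclusion) formula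
`n! V(K₁,…,K_n) = ∑_{S ⊆ [n]} (-1)^{n-#S} Vol(∑_{i∈S} K_i)`, which for convex bodies agrees
with the coefficient definition
`V(K₁,…,K_n) = (1/n!) ∂ⁿ/∂t₁⋯∂t_n Vol(t₁K₁+⋯+t_nK_n)|_{t=0}`. -/
noncomputable def mixedVolume (n : ℕ) (K : Fin n → Set (EuclideanSpace ℝ (Fin n))) : ℝ :=
  ((n.factorial : ℝ))⁻¹ * ∑ s : Finset (Fin n),
    (-1 : ℝ) ^ (n - s.card) * (MeasureTheory.volume (∑ i ∈ s, K i)).toReal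

section MixedVolumeProduct

open MeasureTheory Module

/-- For linear isometries with orthogonal ranges of complementary dimension, the volume of the sum
of the images is the product of the volumes. -/
theorem volume_image_add_image {U V E : Type*}
    [NormedAddCommGroup U] [InnerProductSpace ℝ U] [FiniteDimensional ℝ U]
    [MeasurableSpace U] [BorelSpace U]
    [NormedAddCommGroup V] [InnerProductSpace ℝ V] [FiniteDimensional ℝ V]
    [MeasurableSpace V] [BorelSpace V]
    [NormedAddCommGroup E] [InnerProductSpace ℝ E] [FiniteDimensional ℝ E]
    [MeasurableSpace E] [BorelSpace E]
    (φ : U →ₗᵢ[ℝ] E) (ψ : V →ₗᵢ[ℝ] E) (horth : ∀ x y, inner ℝ (φ x) (ψ y) = 0)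
    (hdim : finrank ℝ U + finrank ℝ V = finrank ℝ E) (A : Set U) (C : Set V) :
    volume (φ '' A + ψ '' C) = volume A * volume C := by
  let f : WithLp 2 (U × V) →ₗ[ℝ] E :=
    (φ.toLinearMap.coprod ψ.toLinearMap) ∘ₗ (WithLp.linearEquiv 2 ℝ (U × V)).toLinearMap
  have hf (p : WithLp 2 (U × V)) : f p = φ p.fst + ψ p.snd := rfl
  let g : WithLp 2 (U × V) →ₗᵢ[ℝ] E :=
    { f with
      norm_map' := fun p => by
        have h := norm_add_sq_eq_norm_sq_add_norm_sq_of_inner_eq_zero _ _ (horth p.fst p.snd)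
        have h' := WithLp.prod_norm_sq_eq_of_L2 p
        rw [φ.norm_map, ψ.norm_map] at h
        change ‖f p‖ = ‖p‖
        rw [hf, ← sq_eq_sq₀ (norm_nonneg _) (norm_nonneg _)]
        linarith }
  have hfin : finrank ℝ (WithLp 2 (U × V)) = finrank ℝ E := by
    rw [(WithLp.linearEquiv 2 ℝ (U × V)).finrank_eq, finrank_prod, hdim]
  let G := g.toLinearIsometryEquiv hfin
  have hmp : MeasurePreserving
      ((MeasurableEquiv.toLp 2 (U × V)).trans G.toHomeomorph.toMeasurableEquiv) :=
    (WithLp.volume_preserving_toLp U V).trans G.measurePreserving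
  have himage : ((MeasurableEquiv.toLp 2 (U × V)).trans G.toHomeomorph.toMeasurableEquiv) ''
      (A ×ˢ C) = φ '' A + ψ '' C := by
    ext z
    simp only [Set.mem_image, Set.mem_add, Set.mem_prod, Prod.exists]
    constructor
    · rintro ⟨a, c, ⟨ha, hc⟩, rfl⟩
      exact ⟨φ a, ⟨a, ha, rfl⟩, ψ c, ⟨c, hc, rfl⟩, rfl⟩
    · rintro ⟨_, ⟨a, ha, rfl⟩, _, ⟨c, hc, rfl⟩, rfl⟩
      exact ⟨a, c, ⟨ha, hc⟩, rfl⟩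
  rw [← himage, ← hmp.measure_preimage_equiv, Set.preimage_image_eq _ (MeasurableEquiv.injective _)]
  exact Measure.prod_prod _ _

/-- A sum of fewer segments from the origin than the dimension of the space is a null set. -/
theorem volume_sum_segment_eq_zero {ι V : Type*}
    [NormedAddCommGroup V] [InnerProductSpace ℝ V] [FiniteDimensional ℝ V]
    [MeasurableSpace V] [BorelSpace V] (v : ι → V) (t : Finset ι)
    (ht : t.card < finrank ℝ V) : volume (∑ k ∈ t, segment ℝ 0 (v k)) = 0 := by
  classical
  let S : Submodule ℝ V := Submodule.span ℝ (t.image v : Finset V)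
  have hS : S ≠ ⊤ := fun h => by
    have hle : finrank ℝ S ≤ (t.image v).card := finrank_span_finset_le_card (t.image v)
    rw [h, finrank_top] at hle
    have := Finset.card_image_le (s := t) (f := v)
    omega
  refine measure_mono_null (fun x hx => ?_) (Measure.addHaar_submodule volume S hS)
  obtain ⟨g, hg, rfl⟩ := Set.mem_finsetSum t _ x |>.1 hx
  refine S.sum_mem fun k hk => ?_
  exact S.convex.segment_subset S.zero_mem
    (Submodule.subset_span (Finset.mem_coe.2 (Finset.mem_image_of_mem v hk))) (hg hk)

end MixedVolumeProduct

/-- Let `B 0, …, B (j-1)` be bounded convex subsets of a `j`-dimensional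
subspace `W ⊆ ℝ^n` (here `W` is the range of a linear isometry `φ : ℝ^j → ℝ^n`, the bodies
are `φ '' B i`, and their joint affine span is all of `W`), and let `u_k = ψ (v k)` be vectors
of `W^⊥` (where `ψ : ℝ^{n-j} → ℝ^n` is a linear isometry with range `W^⊥`).  With
`C = [0,u_{j+1}] + ⋯ + [0,u_n]`, one has
`j! ⬝ V_W(B₁,…,B_j) ⬝ Vol_{W^⊥}(C) = n! ⬝ V(B₁,…,B_j,[0,u_{j+1}],…,[0,u_n])`. -/
theorem stmt15 (n j : ℕ) (hj : j ≤ n)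
    (φ : EuclideanSpace ℝ (Fin j) →ₗᵢ[ℝ] EuclideanSpace ℝ (Fin n))
    (ψ : EuclideanSpace ℝ (Fin (n - j)) →ₗᵢ[ℝ] EuclideanSpace ℝ (Fin n))
    (hψ : LinearMap.range ψ.toLinearMap = (LinearMap.range φ.toLinearMap)ᗮ)
    (B : Fin j → Set (EuclideanSpace ℝ (Fin j)))
    (hBconv : ∀ i, Convex ℝ (B i)) (hBbd : ∀ i, Bornology.IsBounded (B i))
    (hBne : ∀ i, (B i).Nonempty)
    (hspan : (affineSpan ℝ (⋃ i, φ '' B i) : Set (EuclideanSpace ℝ (Fin n)))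
        = (LinearMap.range φ.toLinearMap : Set (EuclideanSpace ℝ (Fin n))))
    (v : Fin (n - j) → EuclideanSpace ℝ (Fin (n - j))) :
    (j.factorial : ℝ) * mixedVolume j B
        * (MeasureTheory.volume (∑ k : Fin (n - j), segment ℝ 0 (v k))).toReal
      = (n.factorial : ℝ) * mixedVolume n (fun i =>
          if h : (i : ℕ) < j then φ '' B ⟨i, h⟩
          else segment ℝ 0 (ψ (v ⟨(i : ℕ) - j, by have := i.isLt; omega⟩))) := by
  have horth (x) (y) : inner ℝ (φ x) (ψ y) = 0 := by
    have hy : ψ y ∈ (LinearMap.range φ.toLinearMap)ᗮ := hψ ▸ ⟨y, rfl⟩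
    exact hy (φ x) ⟨x, rfl⟩
  let e : Fin j ⊕ Fin (n - j) ≃ Fin n := finSumFinEquiv.trans (finCongr (by omega))
  set K : Fin n → Set (EuclideanSpace ℝ (Fin n)) := fun i =>
    if h : (i : ℕ) < j then φ '' B ⟨i, h⟩
    else segment ℝ 0 (ψ (v ⟨(i : ℕ) - j, by have := i.isLt; omega⟩))
  have hKl (i : Fin j) : K (e (.inl i)) = φ '' B i := by simp [K, e]
  have hKr (k : Fin (n - j)) : K (e (.inr k)) = ψ '' segment ℝ 0 (v k) := by
    have := image_segment ℝ ψ.toLinearMap.toAffineMap 0 (v k)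
    simpa [K, e] using this.symm
  have hvol (s : Finset (Fin j)) (t : Finset (Fin (n - j))) :
      MeasureTheory.volume (∑ i ∈ (s.disjSum t).map e.toEmbedding, K i)
        = MeasureTheory.volume (∑ i ∈ s, B i)
          * MeasureTheory.volume (∑ k ∈ t, segment ℝ 0 (v k)) := by
    rw [Finset.sum_map, Finset.sum_disjSum]
    simp only [Equiv.coe_toEmbedding, hKl, hKr]
    rw [← Set.image_finsetSum φ, ← Set.image_finsetSum ψ]
    exact volume_image_add_image φ ψ horth (by simp; omega) _ _
  have hsum : ∑ s : Finset (Fin n),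
        (-1 : ℝ) ^ (n - s.card) * (MeasureTheory.volume (∑ i ∈ s, K i)).toReal
      = ∑ s : Finset (Fin j), ∑ t : Finset (Fin (n - j)),
        (-1 : ℝ) ^ (n - (s.card + t.card)) * ((MeasureTheory.volume (∑ i ∈ s, B i)).toReal
          * (MeasureTheory.volume (∑ k ∈ t, segment ℝ 0 (v k))).toReal) := by
    rw [← Fintype.sum_prod_type']
    refine (Fintype.sum_equiv (Finset.sumEquiv.symm.toEquiv.trans e.finsetCongr) _ _ ?_).symm
    rintro ⟨s, t⟩
    have hst : (Finset.sumEquiv.symm.toEquiv.trans e.finsetCongr) (s, t)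
      = (s.disjSum t).map e.toEmbedding := rfl
    rw [hst, hvol, ENNReal.toReal_mul, Finset.card_map, Finset.card_disjSum]
  have hinner (s : Finset (Fin j)) : ∑ t : Finset (Fin (n - j)),
        (-1 : ℝ) ^ (n - (s.card + t.card)) * ((MeasureTheory.volume (∑ i ∈ s, B i)).toReal
          * (MeasureTheory.volume (∑ k ∈ t, segment ℝ 0 (v k))).toReal)
      = (-1 : ℝ) ^ (j - s.card) * (MeasureTheory.volume (∑ i ∈ s, B i)).toReal
          * (MeasureTheory.volume (∑ k, segment ℝ 0 (v k))).toReal := by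
    rw [Finset.sum_eq_single Finset.univ]
    · rw [Finset.card_univ, Fintype.card_fin, show n - (s.card + (n - j)) = j - s.card by omega,
        mul_assoc]
    · intro t _ ht
      have hcard : t.card < n - j := by
        simpa using (Finset.card_lt_iff_ne_univ t).2 ht
      rw [volume_sum_segment_eq_zero v t (by simpa using hcard)]
      simp
    · simp
  rw [mixedVolume, mixedVolume, mul_inv_cancel_left₀ (by positivity),
    mul_inv_cancel_left₀ (by positivity), hsum, Finset.sum_mul]
  exact Finset.sum_congr rfl fun s _ => (hinner s).symm
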